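/- arXiv:2406.07166 — 3 statements merged into one kernel-verified Lean document; each statement's English description precedes it below -/
import Mathlib

section
/- A function f : ℝ≥0 → ℝ≥0 is ultrametric-preserving if and only if f is amenable (f⁻¹(0) = {0}) and increasing (a ≤ b implies f(a) ≤ f(b) for all a,b ∈ ℝ≥0). -/
open NNReal

universe u

/-- `d : X → X → ℝ≥0` is an ultrametric on `X`. -/
def IsUltrametric {X : Type u} (d : X → X → ℝ≥0) : Prop :=
  (∀ x y, d x y = 0 ↔ x = y) ∧
  (∀ x y, d x y = d y x) ∧
  (∀ x y z, d x y ≤ max (d x z) (d z y))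

/-- `f : ℝ≥0 → ℝ≥0` is ultrametric-preserving: for every set `X` and every
ultrametric `d` on `X`, the composition `f ∘ d` is an ultrametric on `X`. -/
def UltrametricPreserving (f : ℝ≥0 → ℝ≥0) : Prop :=
  ∀ (X : Type u) (d : X → X → ℝ≥0), IsUltrametric d →
    IsUltrametric (fun x y => f (d x y))

/-- The ultrametric on `ℝ≥0` in which distinct points are at distance their maximum. -/
noncomputable def maxDist (x y : ULift.{u} ℝ≥0) : ℝ≥0 :=
  if x = y then 0 else max x.down y.down

theorem maxDist_of_lt {a b : ℝ≥0} (h : a < b) : maxDist.{u} ⟨a⟩ ⟨b⟩ = b := by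
  simp [maxDist, h.ne, h.le]

theorem maxDist_zero_right (a : ℝ≥0) : maxDist.{u} ⟨a⟩ ⟨0⟩ = a := by
  by_cases h : a = 0 <;> simp [maxDist, h]

theorem isUltrametric_maxDist : IsUltrametric maxDist.{u} := by
  refine ⟨fun x y => ⟨fun h => ?_, fun h => by simp [maxDist, h]⟩, fun x y => ?_, fun x y z => ?_⟩
  · by_contra hne
    rw [maxDist, if_neg hne] at h
    have hx : x.down = 0 := le_antisymm (h ▸ le_max_left _ _) zero_le
    have hy : y.down = 0 := le_antisymm (h ▸ le_max_right _ _) zero_le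
    exact hne (ULift.ext _ _ (hx.trans hy.symm))
  · simp only [maxDist, eq_comm (a := x), max_comm x.down]
  · by_cases hxy : x = y
    · simp [maxDist, hxy]
    by_cases hxz : x = z
    · subst hxz
      exact le_max_right _ _
    by_cases hzy : z = y
    · subst hzy
      exact le_max_left _ _
    rw [maxDist, maxDist, maxDist, if_neg hxy, if_neg hxz, if_neg hzy]
    exact max_le_max (le_max_left _ _) (le_max_right _ _)

/-- `f` is ultrametric-preserving iff `f` is amenable and increasing. -/
theorem ultrametricPreserving_iff_amenable_and_increasing (f : ℝ≥0 → ℝ≥0) :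
    UltrametricPreserving.{u} f ↔
      (f ⁻¹' {0} = {0}) ∧ (∀ a b : ℝ≥0, a ≤ b → f a ≤ f b) := by
  constructor
  · intro hf
    obtain ⟨hzero, -, htri⟩ := hf _ _ isUltrametric_maxDist
    refine ⟨Set.ext fun a => ?_, fun a b hab => ?_⟩
    · have h := hzero ⟨a⟩ ⟨0⟩
      simpa [maxDist_zero_right] using h
    · rcases hab.eq_or_lt with rfl | hlt
      · exact le_rfl
      have h := htri ⟨a⟩ ⟨0⟩ ⟨b⟩
      simpa only [maxDist_zero_right, maxDist_of_lt hlt, max_self] using h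
  · rintro ⟨hzero, hmono⟩ X d ⟨hd, hsymm, htri⟩
    have hf (a : ℝ≥0) : f a = 0 ↔ a = 0 := Set.ext_iff.mp hzero a
    have hmono : Monotone f := fun a b => hmono a b
    refine ⟨fun x y => (hf _).trans (hd x y), fun x y => congrArg f (hsymm x y), fun x y z => ?_⟩
    exact (hmono (htri x y z)).trans_eq hmono.map_max
end

section
/- For every function f : ℝ≥0 → ℝ≥0, the following are equivalent: (i) f is increasing and f(0) = 0; (ii) f is pseudoultrametric-preserving. -/
open NNReal

universe u

/-- `d : X → X → ℝ≥0` is a pseudoultrametric on `X`. -/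
def IsPseudoUltrametric {X : Type u} (d : X → X → ℝ≥0) : Prop :=
  (∀ x, d x x = 0) ∧
  (∀ x y, d x y = d y x) ∧
  (∀ x y z, d x y ≤ max (d x z) (d z y))

/-- `f : ℝ≥0 → ℝ≥0` is pseudoultrametric-preserving: for every set `X` and every
pseudoultrametric `d` on `X`, the composition `f ∘ d` is a pseudoultrametric on `X`. -/
def PseudoUltrametricPreserving (f : ℝ≥0 → ℝ≥0) : Prop :=
  ∀ (X : Type u) (d : X → X → ℝ≥0), IsPseudoUltrametric d →
    IsPseudoUltrametric (fun x y => f (d x y))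

/-- The isosceles triangle with base `a` and legs `b`, with apex `none`. -/
def isoscelesDist (a b : ℝ≥0) (x y : ULift.{u} (Option Bool)) : ℝ≥0 :=
  if x = y then 0 else if x.down = none ∨ y.down = none then b else a

theorem isPseudoUltrametric_isoscelesDist {a b : ℝ≥0} (h : a ≤ b) :
    IsPseudoUltrametric (isoscelesDist.{u} a b) := by
  refine ⟨fun x => by simp [isoscelesDist], fun x y => ?_, ?_⟩
  · simp only [isoscelesDist, eq_comm, or_comm]
  · rintro ⟨_ | _ | _⟩ ⟨_ | _ | _⟩ ⟨_ | _ | _⟩ <;> simp [isoscelesDist, h]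

/-- `f` is increasing with `f 0 = 0` iff `f` is
pseudoultrametric-preserving. -/
theorem increasing_and_zero_iff_pseudoUltrametricPreserving (f : ℝ≥0 → ℝ≥0) :
    ((∀ a b : ℝ≥0, a ≤ b → f a ≤ f b) ∧ f 0 = 0) ↔
      PseudoUltrametricPreserving.{u} f := by
  constructor
  · rintro ⟨hf, h0⟩ X d ⟨h_self, h_comm, h_tri⟩
    refine ⟨fun x => by simp [h_self, h0], fun x y => by simp only [h_comm x y], fun x y z => ?_⟩
    have h_mono : Monotone f := fun a b => hf a b
    exact (h_mono (h_tri x y z)).trans_eq h_mono.map_max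
  · intro hf
    refine ⟨fun a b hab => ?_, ?_⟩
    · simpa [isoscelesDist] using
        (hf _ _ (isPseudoUltrametric_isoscelesDist hab)).2.2 ⟨some false⟩ ⟨some true⟩ ⟨none⟩
    · simpa [isoscelesDist] using
        (hf _ _ (isPseudoUltrametric_isoscelesDist (le_refl 0))).1 ⟨none⟩
end

section
/- A function f : ℝ≥0 → ℝ≥0 is pseudoultrametric-preserving if and only if f is an endomorphism of the monoid (ℝ≥0, max); that is, if and only if f(0) = 0 and f(max(a,b)) = max(f(a), f(b)) for all a,b ∈ ℝ≥0. -/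
open NNReal

universe u

/-- On `ℝ≥0`, sending a pair of distinct points to their maximum defines a pseudoultrametric. -/
theorem isPseudoUltrametric_ite_max :
    IsPseudoUltrametric (fun x y : ULift.{u} ℝ≥0 =>
      if x.down = y.down then (0 : ℝ≥0) else max x.down y.down) := by
  refine ⟨fun x => by simp, fun x y => by simp only [eq_comm, max_comm], ?_⟩
  rintro ⟨x⟩ ⟨y⟩ ⟨z⟩
  dsimp only
  by_cases hxy : x = y
  · simp [hxy]
  by_cases hxz : x = z
  · simp [hxy, ← hxz]
  by_cases hzy : z = y
  · simp [hxy, hzy]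
  simp only [hxy, hxz, hzy, if_false]
  exact max_le_max (le_max_left x z) (le_max_right z y)

theorem PseudoUltrametricPreserving.map_zero {f : ℝ≥0 → ℝ≥0}
    (hf : PseudoUltrametricPreserving.{u} f) : f 0 = 0 := by
  simpa using (hf _ _ isPseudoUltrametric_ite_max).1 ⟨0⟩

theorem PseudoUltrametricPreserving.monotone {f : ℝ≥0 → ℝ≥0}
    (hf : PseudoUltrametricPreserving.{u} f) : Monotone f := by
  intro a b hab
  rcases eq_or_ne a 0 with rfl | ha
  · simp [hf.map_zero]
  rcases hab.eq_or_lt with rfl | hlt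
  · exact le_rfl
  have hb : b ≠ 0 := (pos_of_gt hlt).ne'
  simpa [ha.symm, hb.symm, hlt.ne', hab] using
    (hf _ _ isPseudoUltrametric_ite_max).2.2 ⟨0⟩ ⟨a⟩ ⟨b⟩

theorem IsPseudoUltrametric.comp_monotone {X : Type u} {d : X → X → ℝ≥0}
    (hd : IsPseudoUltrametric d) {f : ℝ≥0 → ℝ≥0} (hf0 : f 0 = 0) (hf : Monotone f) :
    IsPseudoUltrametric (fun x y => f (d x y)) := by
  refine ⟨fun x => by simp [hd.1, hf0], fun x y => congrArg f (hd.2.1 x y), fun x y z => ?_⟩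
  rw [← hf.map_max]
  exact hf (hd.2.2 x y z)

/-- `f` is pseudoultrametric-preserving iff `f` is an endomorphism of
the monoid `(ℝ≥0, max)`, i.e. `f 0 = 0` and `f (max a b) = max (f a) (f b)`. -/
theorem pseudoUltrametricPreserving_iff_max_endomorphism (f : ℝ≥0 → ℝ≥0) :
    PseudoUltrametricPreserving.{u} f ↔
      (f 0 = 0 ∧ ∀ a b : ℝ≥0, f (max a b) = max (f a) (f b)) := by
  refine ⟨fun hf => ⟨hf.map_zero, fun a b => hf.monotone.map_max⟩, ?_⟩
  rintro ⟨hf0, hmax⟩ X d hd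
  refine hd.comp_monotone hf0 fun a b hab => ?_
  rw [← max_eq_right hab, hmax]
  exact le_max_left _ _
end
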